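/- Let 0 < p < √6/π, let n range over odd integers n ≥ 3, and let θ_n ∈ [0, π/2] be arbitrary. For each such n define the unit vector s'_{(n-1)/2} = -sin(θ_n) c_{(n-1)/2} + cos(θ_n) s_{(n-1)/2} ∈ ℝ^n and the vertex subset S_n = { k mod n : k ∈ ℤ, ⌈-np/2 - nθ_n/π⌉ ≤ k ≤ ⌊np/2 - nθ_n/π⌋ } ⊆ {0,...,n-1}. Then |S_n|/n → p as n → ∞ and limsup_{n→∞} μ_{s'_{(n-1)/2}}(S_n) ≤ π²p³/6 < p. In particular, μ_{s'_{(n-1)/2}}(S_n) does not converge to p. -/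

import Mathlib

open scoped Real

/-- `c_j ∈ ℝ^n`, with `k`-th entry `√(2/n) cos(2πjk/n)`. -/
noncomputable def cvec (n j : ℕ) : Fin n → ℝ :=
  fun k => Real.sqrt (2 / n) * Real.cos (2 * π * j * (k : ℕ) / n)

/-- `s_j ∈ ℝ^n`, with `k`-th entry `√(2/n) sin(2πjk/n)`. -/
noncomputable def svec (n j : ℕ) : Fin n → ℝ :=
  fun k => Real.sqrt (2 / n) * Real.sin (2 * π * j * (k : ℕ) / n)

/-- The vector `s'_{(n-1)/2} = -sin(θ) c_{(n-1)/2} + cos(θ) s_{(n-1)/2} ∈ ℝ^n`. -/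
noncomputable def sprime (n : ℕ) (θ : ℝ) : Fin n → ℝ :=
  fun k => -Real.sin θ * cvec n ((n - 1) / 2) k + Real.cos θ * svec n ((n - 1) / 2) k

-- The vertex subset
-- `S_n = { k mod n : k ∈ ℤ, ⌈-np/2 - nθ/π⌉ ≤ k ≤ ⌊np/2 - nθ/π⌋ } ⊆ {0,…,n-1}`:
-- a vertex `v` belongs to `S_n` iff some integer `k` in that range is congruent
-- to `v` mod `n`.
open scoped Classical in
noncomputable def Sshift (p θ : ℝ) (n : ℕ) : Finset (Fin n) :=
  Finset.univ.filter fun v =>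
    ∃ k ∈ Finset.Icc ⌈-((n : ℝ) * p / 2) - (n : ℝ) * θ / π⌉
        ⌊(n : ℝ) * p / 2 - (n : ℝ) * θ / π⌋,
      (k : ZMod n) = ((v : ℕ) : ZMod n)

/-- The filter of `n → ∞` along odd integers. -/
def oddAtTop : Filter ℕ := Filter.atTop ⊓ Filter.principal {n | Odd n}

theorem sprime_sq {n : ℕ} (hn : Odd n) (θ : ℝ) (v : Fin n) (k : ℤ)
    (hk : (k : ZMod n) = ((v : ℕ) : ZMod n)) :
    sprime n θ v ^ 2 = 2 / n * Real.sin (π * k / n + θ) ^ 2 := by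
  have hn0 : (n : ℝ) ≠ 0 := by exact_mod_cast hn.pos.ne'
  have hsq : ∀ (x : ℝ) (m : ℤ), Real.sin (x + m * π) ^ 2 = Real.sin x ^ 2 := by
    intro x m
    rw [Real.sin_add_int_mul_pi, mul_pow, ← zpow_natCast, ← zpow_mul, mul_comm m, zpow_mul]
    simp
  obtain ⟨t, ht⟩ : (n : ℤ) ∣ k - (v : ℕ) := by
    rw [← ZMod.intCast_eq_intCast_iff_dvd_sub]
    exact_mod_cast hk.symm
  have ht' : (k : ℝ) = (v : ℕ) + n * t := by
    have : k = (v : ℕ) + n * t := by linarith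
    exact_mod_cast this
  have hcast : (((n - 1) / 2 : ℕ) : ℝ) = ((n : ℝ) - 1) / 2 := by
    obtain ⟨m, rfl⟩ := hn
    have : (2 * m + 1 - 1) / 2 = m := by omega
    rw [this]
    push_cast
    ring
  have hs : sprime n θ v
      = Real.sqrt (2 / n) * Real.sin (-(π * (v : ℕ) / n + θ) + ((v : ℕ) : ℤ) * π) := by
    have harg : -(π * (v : ℕ) / n + θ) + ((v : ℕ) : ℤ) * π
        = 2 * π * ((n - 1) / 2 : ℕ) * (v : ℕ) / n - θ := by
      rw [hcast]
      push_cast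
      field_simp
      ring
    rw [harg, Real.sin_sub]
    simp only [sprime, cvec, svec]
    ring
  have hk' : π * k / n + θ = π * (v : ℕ) / n + θ + t * π := by
    rw [ht']
    field_simp
    ring
  rw [hs, mul_pow, hsq, Real.sq_sqrt (by positivity), hk', hsq, Real.sin_neg, neg_sq]

theorem sum_cos_eq_zero {n : ℕ} (hn : 2 ≤ n) (φ : ℝ) :
    ∑ k ∈ Finset.range n, Real.cos (2 * π * k / n + φ) = 0 := by
  have hn0 : (n : ℝ) ≠ 0 := by positivity
  have hsin : 0 < Real.sin (π / n) := by
    apply Real.sin_pos_of_pos_of_lt_pi (by positivity)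
    exact div_lt_self Real.pi_pos (by exact_mod_cast hn)
  have hstep : ∀ k : ℕ, 2 * Real.sin (π / n) * Real.cos (2 * π * k / n + φ)
      = Real.sin (2 * π * (k + 1 : ℕ) / n + φ - π / n)
        - Real.sin (2 * π * k / n + φ - π / n) := by
    intro k
    have h1 : 2 * π * (k + 1 : ℕ) / n + φ - π / n = (2 * π * k / n + φ) + π / n := by
      push_cast
      ring
    rw [h1, Real.sin_add, Real.sin_sub]
    ring
  have h : 2 * Real.sin (π / n) * ∑ k ∈ Finset.range n, Real.cos (2 * π * k / n + φ) = 0 := by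
    rw [Finset.mul_sum, Finset.sum_congr rfl fun k _ => hstep k,
      Finset.sum_range_sub fun k : ℕ => Real.sin (2 * π * k / n + φ - π / n)]
    have h1 : 2 * π * n / n + φ - π / n = φ - π / n + 2 * π := by
      field_simp
      ring
    have h2 : 2 * π * (0 : ℕ) / n + φ - π / n = φ - π / n := by simp
    rw [h1, h2, Real.sin_add_two_pi, sub_self]
  exact (mul_eq_zero.mp h).resolve_left (by positivity)

theorem sum_sprime_sq {n : ℕ} (hn : Odd n) (h3 : 3 ≤ n) (θ : ℝ) :
    ∑ k : Fin n, sprime n θ k ^ 2 = 1 := by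
  have hn0 : (n : ℝ) ≠ 0 := by positivity
  have h : ∀ v : Fin n,
      sprime n θ v ^ 2 = 1 / n - 1 / n * Real.cos (2 * π * (v : ℕ) / n + 2 * θ) := by
    intro v
    rw [sprime_sq hn θ v (v : ℕ) (by simp), Real.sin_sq_eq_half_sub]
    have : 2 * (π * (((v : ℕ) : ℤ) : ℝ) / n + θ) = 2 * π * (v : ℕ) / n + 2 * θ := by
      push_cast
      ring
    rw [this]
    ring
  rw [Finset.sum_congr rfl fun v _ => h v,
    Fin.sum_univ_eq_sum_range
      (fun k : ℕ => (1 : ℝ) / n - 1 / n * Real.cos (2 * π * k / n + 2 * θ)) n,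
    Finset.sum_sub_distrib, ← Finset.mul_sum, sum_cos_eq_zero (by omega)]
  simp [hn0]

theorem sum_Sshift {p θ : ℝ} {n : ℕ} (hn : 0 < n) (hp : p < 1) (f : Fin n → ℝ) (g : ℤ → ℝ)
    (hfg : ∀ (v : Fin n) (k : ℤ), (k : ZMod n) = ((v : ℕ) : ZMod n) → f v = g k) :
    ∑ v ∈ Sshift p θ n, f v
      = ∑ k ∈ Finset.Icc ⌈-((n : ℝ) * p / 2) - (n : ℝ) * θ / π⌉
          ⌊(n : ℝ) * p / 2 - (n : ℝ) * θ / π⌋, g k := by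
  have hn' : (n : ℤ) ≠ 0 := by exact_mod_cast hn.ne'
  have hpn : (n : ℝ) * p < n := mul_lt_of_lt_one_right (by exact_mod_cast hn) hp
  have hr : ∀ k : ℤ, (((k % n).toNat : ℕ) : ℤ) = k % n := fun k =>
    Int.toNat_of_nonneg (Int.emod_nonneg k hn')
  have hlt : ∀ k : ℤ, (k % n).toNat < n := by
    intro k
    have := Int.emod_lt_of_pos k (b := n) (by exact_mod_cast hn)
    have := hr k
    omega
  have hz : ∀ k : ℤ, (k : ZMod n) = (((k % n).toNat : ℕ) : ZMod n) := by
    intro k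
    have : (((k % n).toNat : ℕ) : ZMod n) = ((((k % n).toNat : ℕ) : ℤ) : ZMod n) :=
      (Int.cast_natCast _).symm
    rw [this, hr, ZMod.intCast_mod]
  symm
  refine Finset.sum_bij (fun k _ => (⟨(k % n).toNat, hlt k⟩ : Fin n)) ?_ ?_ ?_ ?_
  · intro k hk
    simp only [Sshift, Finset.mem_filter, Finset.mem_univ, true_and]
    exact ⟨k, hk, hz k⟩
  · intro k hk l hl hkl
    have hmod : k % n = l % n := by
      rw [← hr k, ← hr l]
      exact_mod_cast congrArg Fin.val hkl
    rw [Finset.mem_Icc, Int.ceil_le, Int.le_floor] at hk hl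
    have h1 : ((k - l : ℤ) : ℝ) < (n : ℤ) := by
      push_cast
      linarith [hk.2, hl.1]
    have h2 : ((l - k : ℤ) : ℝ) < (n : ℤ) := by
      push_cast
      linarith [hl.2, hk.1]
    rw [Int.cast_lt] at h1 h2
    have h0 := Int.eq_zero_of_abs_lt_dvd (Int.ModEq.dvd (Eq.symm hmod))
      (abs_lt.mpr ⟨by linarith, h1⟩)
    linarith
  · intro v hv
    simp only [Sshift, Finset.mem_filter, Finset.mem_univ, true_and] at hv
    obtain ⟨k, hk, hkv⟩ := hv
    refine ⟨k, hk, Fin.ext ?_⟩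
    have h := (hz k).symm.trans hkv
    rw [ZMod.natCast_eq_natCast_iff'] at h
    rwa [Nat.mod_eq_of_lt (hlt k), Nat.mod_eq_of_lt v.2] at h
  · intro k _
    exact (hfg _ k (hz k)).symm

theorem sum_Icc_int_sub (f : ℤ → ℝ) {a b : ℤ} (hab : a ≤ b + 1) :
    ∑ k ∈ Finset.Icc a b, (f (k + 1) - f k) = f (b + 1) - f a := by
  obtain ⟨m, hm⟩ := Int.eq_ofNat_of_zero_le (sub_nonneg.mpr hab)
  obtain rfl : b = a + m - 1 := by linarith
  clear hm hab
  induction m with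
  | zero => simp
  | succ m ih =>
    have : Finset.Icc a (a + (m + 1 : ℕ) - 1) = insert (a + m) (Finset.Icc a (a + m - 1)) := by
      ext x
      simp only [Finset.mem_Icc, Finset.mem_insert]
      omega
    rw [this, Finset.sum_insert (by simp), ih]
    push_cast
    ring_nf

theorem sum_sq_Icc_le {L : ℝ} (hL : 0 ≤ L) (α : ℝ) :
    ∑ k ∈ Finset.Icc ⌈-L - α⌉ ⌊L - α⌋, ((k : ℝ) + α) ^ 2 ≤ 2 * (L + 1 / 2) ^ 3 / 3 := by
  have hab : ⌈-L - α⌉ ≤ ⌊L - α⌋ + 1 := by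
    rw [Int.ceil_le]
    push_cast
    linarith [Int.lt_floor_add_one (L - α)]
  have hmono : Monotone fun x : ℝ => x ^ 3 := (Odd.strictMono_pow (by decide)).monotone
  calc ∑ k ∈ Finset.Icc ⌈-L - α⌉ ⌊L - α⌋, ((k : ℝ) + α) ^ 2
      ≤ ∑ k ∈ Finset.Icc ⌈-L - α⌉ ⌊L - α⌋,
          ((((k + 1 : ℤ) : ℝ) + α - 1 / 2) ^ 3 / 3 - ((k : ℝ) + α - 1 / 2) ^ 3 / 3) := by
        refine Finset.sum_le_sum fun k _ => ?_
        push_cast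
        nlinarith
    _ = (((⌊L - α⌋ + 1 : ℤ) : ℝ) + α - 1 / 2) ^ 3 / 3
          - ((⌈-L - α⌉ : ℝ) + α - 1 / 2) ^ 3 / 3 :=
        sum_Icc_int_sub (fun k => ((k : ℝ) + α - 1 / 2) ^ 3 / 3) hab
    _ ≤ (L + 1 / 2) ^ 3 / 3 - (-(L + 1 / 2)) ^ 3 / 3 := by
        have h1 := hmono (show ((⌊L - α⌋ + 1 : ℤ) : ℝ) + α - 1 / 2 ≤ L + 1 / 2 by
          push_cast
          linarith [Int.floor_le (L - α)])
        have h2 := hmono (show -(L + 1 / 2) ≤ (⌈-L - α⌉ : ℝ) + α - 1 / 2 by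
          linarith [Int.le_ceil (-L - α)])
        simp only at h1 h2
        linarith
    _ = 2 * (L + 1 / 2) ^ 3 / 3 := by ring

theorem sum_Sshift_sprime_sq_le {p : ℝ} (hp0 : 0 ≤ p) (hp : p < 1) (θ : ℝ) {n : ℕ}
    (hn : Odd n) :
    ∑ k ∈ Sshift p θ n, sprime n θ k ^ 2 ≤ π ^ 2 * (p + 1 / n) ^ 3 / 6 := by
  have hn0 : (n : ℝ) ≠ 0 := by exact_mod_cast hn.pos.ne'
  rw [sum_Sshift hn.pos hp _ _ (sprime_sq hn θ)]
  calc _ ≤ ∑ k ∈ Finset.Icc ⌈-((n : ℝ) * p / 2) - (n : ℝ) * θ / π⌉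
          ⌊(n : ℝ) * p / 2 - (n : ℝ) * θ / π⌋,
          2 * π ^ 2 / n ^ 3 * ((k : ℝ) + (n : ℝ) * θ / π) ^ 2 := by
        refine Finset.sum_le_sum fun k _ => ?_
        have h : 2 * π ^ 2 / n ^ 3 * ((k : ℝ) + (n : ℝ) * θ / π) ^ 2
            = 2 / n * (π * k / n + θ) ^ 2 := by
          have := Real.pi_ne_zero
          field_simp
        rw [h]
        exact mul_le_mul_of_nonneg_left (sq_le_sq.mpr Real.abs_sin_le_abs) (by positivity)
    _ ≤ 2 * π ^ 2 / n ^ 3 * (2 * ((n : ℝ) * p / 2 + 1 / 2) ^ 3 / 3) := by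
        rw [← Finset.mul_sum]
        exact mul_le_mul_of_nonneg_left (sum_sq_Icc_le (by positivity) _) (by positivity)
    _ = π ^ 2 * (p + 1 / n) ^ 3 / 6 := by
        field_simp
        ring

theorem abs_card_Sshift_div_sub_le {p : ℝ} (hp0 : 0 ≤ p) (hp : p < 1) (θ : ℝ) {n : ℕ}
    (hn : 0 < n) : |((Sshift p θ n).card : ℝ) / n - p| ≤ 1 / n := by
  have hn0 : (0 : ℝ) < n := by exact_mod_cast hn
  have hL : 0 ≤ (n : ℝ) * p / 2 := by positivity
  have h := sum_Sshift (θ := θ) hn hp (fun _ => 1) (fun _ => 1) fun _ _ _ => rfl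
  set a := ⌈-((n : ℝ) * p / 2) - (n : ℝ) * θ / π⌉ with ha
  set b := ⌊(n : ℝ) * p / 2 - (n : ℝ) * θ / π⌋ with hb
  have ha1 := Int.le_ceil (-((n : ℝ) * p / 2) - (n : ℝ) * θ / π)
  have ha2 := Int.ceil_lt_add_one (-((n : ℝ) * p / 2) - (n : ℝ) * θ / π)
  have hb1 := Int.floor_le ((n : ℝ) * p / 2 - (n : ℝ) * θ / π)
  have hb2 := Int.lt_floor_add_one ((n : ℝ) * p / 2 - (n : ℝ) * θ / π)
  rw [← ha] at ha1 ha2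
  rw [← hb] at hb1 hb2
  have hab : a ≤ b + 1 := by
    rw [ha, Int.ceil_le]
    push_cast
    linarith
  have hsum : ∑ k ∈ Finset.Icc a b, (1 : ℝ) = (b : ℝ) + 1 - a := by
    simpa using sum_Icc_int_sub (fun k => (k : ℝ)) hab
  rw [hsum, Finset.sum_const, nsmul_eq_mul, mul_one] at h
  rw [h, show ((b : ℝ) + 1 - a) / n - p = ((b : ℝ) + 1 - a - n * p) / n by field_simp,
    abs_div, abs_of_pos hn0]
  gcongr
  rw [abs_le]
  constructor <;> linarith

instance oddAtTop_neBot : oddAtTop.NeBot := by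
  rw [oddAtTop, ← Filter.frequently_mem_iff_neBot]
  exact Nat.frequently_odd

theorem oddAtTop_le_atTop : oddAtTop ≤ Filter.atTop := inf_le_left

theorem eventually_odd_oddAtTop : ∀ᶠ n in oddAtTop, Odd n :=
  Filter.mem_inf_of_right (Filter.mem_principal_self _)

theorem statement13 (p : ℝ) (hp0 : 0 < p) (hp1 : p < Real.sqrt 6 / π)
    (θ : ℕ → ℝ) (hθ : ∀ n, θ n ∈ Set.Icc 0 (π / 2)) :
    -- for odd `n ≥ 3`, `s'_{(n-1)/2}` is a unit vector,
    (∀ n : ℕ, Odd n → 3 ≤ n → ∑ k : Fin n, sprime n (θ n) k ^ 2 = 1) ∧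
    -- `|S_n|/n → p` as `n → ∞` along odd `n`,
    Filter.Tendsto (fun n => ((Sshift p (θ n) n).card : ℝ) / n) oddAtTop (nhds p) ∧
    -- `limsup μ_{s'_{(n-1)/2}}(S_n) ≤ π²p³/6 < p`,
    Filter.limsup (fun n => ∑ k ∈ Sshift p (θ n) n, sprime n (θ n) k ^ 2) oddAtTop
      ≤ π ^ 2 * p ^ 3 / 6 ∧
    π ^ 2 * p ^ 3 / 6 < p ∧
    -- and in particular `μ_{s'_{(n-1)/2}}(S_n)` does not converge to `p`.
    ¬ Filter.Tendsto (fun n => ∑ k ∈ Sshift p (θ n) n, sprime n (θ n) k ^ 2)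
        oddAtTop (nhds p) := by
  have hπ := Real.pi_pos
  have hpπ : p * π < Real.sqrt 6 := (lt_div_iff₀ hπ).mp hp1
  have hpπ2 : (p * π) ^ 2 < 6 := by
    have := pow_lt_pow_left₀ hpπ (by positivity) two_ne_zero
    rwa [Real.sq_sqrt (by norm_num)] at this
  have hp : p < 1 := by
    by_contra! h
    nlinarith [Real.pi_gt_three, mul_le_mul_of_nonneg_right h hπ.le]
  have hlt : π ^ 2 * p ^ 3 / 6 < p := by
    have : p * (p * π) ^ 2 < p * 6 := mul_lt_mul_of_pos_left hpπ2 hp0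
    linarith [show p * (p * π) ^ 2 = π ^ 2 * p ^ 3 by ring]
  have hinv : Filter.Tendsto (fun n : ℕ => (1 : ℝ) / n) oddAtTop (nhds 0) :=
    tendsto_one_div_atTop_nhds_zero_nat.mono_left oddAtTop_le_atTop
  have hbound : Filter.Tendsto (fun n : ℕ => π ^ 2 * (p + 1 / (n : ℝ)) ^ 3 / 6) oddAtTop
      (nhds (π ^ 2 * p ^ 3 / 6)) := by
    simpa using (((hinv.const_add p).pow 3).const_mul (π ^ 2)).div_const 6
  have hle : ∀ᶠ n in oddAtTop, ∑ k ∈ Sshift p (θ n) n, sprime n (θ n) k ^ 2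
      ≤ π ^ 2 * (p + 1 / (n : ℝ)) ^ 3 / 6 :=
    eventually_odd_oddAtTop.mono fun n hn => sum_Sshift_sprime_sq_le hp0.le hp (θ n) hn
  refine ⟨fun n hn h3 => sum_sprime_sq hn h3 (θ n), ?_, ?_, hlt, ?_⟩
  · rw [tendsto_iff_dist_tendsto_zero]
    refine squeeze_zero' (.of_forall fun _ => dist_nonneg) ?_ hinv
    exact eventually_odd_oddAtTop.mono fun n hn =>
      abs_card_Sshift_div_sub_le hp0.le hp (θ n) hn.pos
  · rw [← hbound.limsup_eq]
    refine Filter.limsup_le_limsup hle ?_ hbound.isBoundedUnder_le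
    exact (Filter.isBoundedUnder_of ⟨0, fun n =>
      Finset.sum_nonneg fun k _ => sq_nonneg _⟩).isCoboundedUnder_le
  · intro h
    exact absurd (le_of_tendsto_of_tendsto h hbound hle) (not_le.mpr hlt)
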